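/- arXiv:0706.1546 — 4 statements merged into one kernel-verified Lean document; each statement's English description precedes it below -/
import Mathlib

section
/- For every x₀ ∈ U ∩ ℝ, the function z ↦ Im(φ(z)) / Im(z) tends to the real number φ'(x₀) as z tends to x₀ within the set {z ∈ ℂ : Im z ≠ 0}. -/
open Filter

open Asymptotics Topology in
/-- If `f` is strictly differentiable at a real point `x` and real-valued on the real line near
`x`, then `Im (f z) / Im z` tends to the real part of the derivative as `z → x` off the real
line. -/
theorem HasStrictDerivAt.tendsto_im_div_im {f : ℂ → ℂ} {f' : ℂ} {x : ℂ}
    (hf : HasStrictDerivAt f f' x) (hx : x.im = 0)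
    (hreal : ∀ᶠ z in 𝓝 x, z.im = 0 → (f z).im = 0) :
    Tendsto (fun z : ℂ => (f z).im / z.im) (𝓝[{z : ℂ | z.im ≠ 0}] x) (𝓝 f'.re) := by
  have hre : Tendsto (fun z : ℂ => (z.re : ℂ)) (𝓝 x) (𝓝 x) := by
    have h : Continuous fun z : ℂ => (z.re : ℂ) := by fun_prop
    simpa only [Complex.ext (Complex.ofReal_re x.re) (by simp [hx] : ((x.re : ℂ)).im = x.im)]
      using h.tendsto x
  have hsub (z : ℂ) : z - z.re = z.im * Complex.I := by
    apply Complex.ext <;> simp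
  have hlittle : (fun z : ℂ => f z - f z.re - (z - z.re) • f') =o[𝓝 x] fun z => z - z.re :=
    hf.hasStrictFDerivAt.isLittleO.comp_tendsto (tendsto_id.prodMk_nhds hre)
  have him : (fun z : ℂ => (f z).im - f'.re * z.im) =o[𝓝 x] fun z => z.im := by
    refine (IsBigO.of_bound 1 ?_).trans_isLittleO (hlittle.trans_isBigO ?_)
    · filter_upwards [hre.eventually hreal] with z hz
      have h := Complex.abs_im_le_norm (f z - f z.re - (z - z.re) • f')
      rw [hsub] at h
      simpa [hsub, hz (Complex.ofReal_im _), mul_comm] using h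
    · exact IsBigO.of_bound 1 (.of_forall fun z => by simp [hsub])
  have hlim := (him.mono (nhdsWithin_le_nhds (s := {z : ℂ | z.im ≠ 0})))
    |>.tendsto_div_nhds_zero.add_const f'.re
  rw [zero_add] at hlim
  refine hlim.congr' ?_
  filter_upwards [self_mem_nhdsWithin] with z (hz : z.im ≠ 0)
  field_simp
  ring

/-- If `U ⊆ ℂ` is open, connected, invariant under complex conjugation and contains a real
point, and `φ` is holomorphic on `U` and real-valued on `U ∩ ℝ`, then for every real point
`x₀ ∈ U` the quotient `Im (φ z) / Im z` tends to the real number `φ' x₀` as `z → x₀` within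
`{z : Im z ≠ 0}`. -/
theorem stmt_2 (U : Set ℂ) (hUopen : IsOpen U) (hUconn : IsConnected U)
    (hUconj : ∀ z : ℂ, z ∈ U ↔ (starRingEnd ℂ) z ∈ U)
    (hUreal : ∃ x ∈ U, x.im = 0)
    (φ : ℂ → ℂ) (hφ : DifferentiableOn ℂ φ U)
    (hφreal : ∀ x ∈ U, x.im = 0 → (φ x).im = 0)
    (x₀ : ℂ) (hx₀ : x₀ ∈ U) (hx₀real : x₀.im = 0) :
    Tendsto (fun z : ℂ => (φ z).im / z.im) (nhdsWithin x₀ {z : ℂ | z.im ≠ 0})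
      (nhds ((deriv φ x₀).re)) := by
  have hU : U ∈ nhds x₀ := hUopen.mem_nhds hx₀
  have hstrict : HasStrictDerivAt φ (deriv φ x₀) x₀ :=
    (hφ.analyticAt hU).hasStrictDerivAt
  refine hstrict.tendsto_im_div_im hx₀real ?_
  filter_upwards [hU] with z hz using hφreal z hz
end

section
/- The function F : ℂ → ℂ defined by F(z) = (φ(z) − conj(φ(z))) / (z − conj(z)) when Im z ≠ 0 and F(x) = φ'(x) when Im x = 0 is real-analytic on U (as a map of ℂ regarded as a two-dimensional real vector space), and F(z) = Im(φ(z))/Im(z) for every z ∈ U with Im z ≠ 0. -/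
open Filter Topology ComplexConjugate

/-- Superposition by an analytic function is analytic at constants in the space of continuous
functions on a compact space. -/
lemma exists_analyticAt_superposition (K : Type*) [TopologicalSpace K] [CompactSpace K]
    [Nonempty K]
    {g : ℂ → ℂ} {x : ℂ} (hg : AnalyticAt ℂ g x) :
    ∃ G : C(K, ℂ) → C(K, ℂ), AnalyticAt ℂ G (ContinuousMap.const K x) ∧
      ∀ᶠ f in 𝓝 (ContinuousMap.const K x), ∀ t, G f t = g (f t) := by
  obtain ⟨p, r, hp⟩ := hg
  set P := FormalMultilinearSeries.ofScalars C(K, ℂ) p.coeff with hP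
  have hrad : p.radius ≤ P.radius := FormalMultilinearSeries.radius_le_of_le fun n ↦ by
    rw [hP, FormalMultilinearSeries.ofScalars_norm,
      FormalMultilinearSeries.norm_apply_eq_norm_coef]
  have hPpos : 0 < P.radius := (hp.r_pos.trans_le hp.r_le).trans_le hrad
  have hPs := P.hasFPowerSeriesOnBall hPpos
  refine ⟨fun f ↦ P.sum (f - ContinuousMap.const K x), ?_, ?_⟩
  · refine AnalyticAt.fun_comp (g := P.sum) ?_ (by fun_prop)
    simpa using hPs.analyticAt
  · filter_upwards [Metric.eball_mem_nhds (ContinuousMap.const K x) hp.r_pos] with f hf t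
    set h := f - ContinuousMap.const K x with hh
    have hmem : h ∈ Metric.eball (0 : C(K, ℂ)) r := by
      simpa [hh, edist_eq_enorm_sub] using hf
    have hsum := hPs.hasSum (Metric.eball_subset_eball (hp.r_le.trans hrad) hmem)
    have hev := hsum.mapL (ContinuousMap.evalCLM ℂ t)
    have hmem' : h t ∈ Metric.eball (0 : ℂ) r := by
      rw [mem_eball_zero_iff] at hmem ⊢
      exact (enorm_le_iff_norm_le.2 (h.norm_coe_le_norm t)).trans_lt hmem
    have hs := hp.hasSum hmem'
    have : x + h t = f t := by simp [hh]
    rw [this] at hs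
    refine HasSum.unique ?_ hs
    simpa [hP, FormalMultilinearSeries.ofScalars_apply_eq, mul_comm] using hev

/-- Integration over the unit interval, as a continuous linear functional. -/
noncomputable def unitIntervalIntegralCLM : C(unitInterval, ℂ) →L[ℂ] ℂ :=
  LinearMap.mkContinuous
    { toFun := fun f ↦ ∫ t in (0 : ℝ)..1, f (Set.projIcc 0 1 zero_le_one t)
      map_add' := fun f g ↦ by
        simp only [ContinuousMap.add_apply]
        exact intervalIntegral.integral_add
          ((f.continuous.comp continuous_projIcc).intervalIntegrable _ _)
          ((g.continuous.comp continuous_projIcc).intervalIntegrable _ _)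
      map_smul' := fun c f ↦ by simp } 1 fun f ↦ by
    simpa using intervalIntegral.norm_integral_le_of_norm_le_const (a := 0) (b := 1)
      fun t _ ↦ f.norm_coe_le_norm (Set.projIcc 0 1 zero_le_one t)

lemma unitIntervalIntegralCLM_apply (f : C(unitInterval, ℂ)) :
    unitIntervalIntegralCLM f = ∫ t in (0 : ℝ)..1, f (Set.projIcc 0 1 zero_le_one t) :=
  rfl

/-- The divided difference of an analytic function is jointly analytic at diagonal points. -/
lemma AnalyticAt.dslope_diag {φ : ℂ → ℂ} {x : ℂ} (hφ : AnalyticAt ℂ φ x) :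
    AnalyticAt ℂ (fun p : ℂ × ℂ ↦ dslope φ p.1 p.2) (x, x) := by
  obtain ⟨G, hG, hGe⟩ := exists_analyticAt_superposition unitInterval hφ.deriv
  let ι : C(unitInterval, ℂ) := ⟨fun t ↦ ((t : ℝ) : ℂ), by fun_prop⟩
  let seg : ℂ × ℂ → C(unitInterval, ℂ) := fun p ↦
    p.1 • (1 : C(unitInterval, ℂ)) + (p.2 - p.1) • ι
  have hseg_apply (p : ℂ × ℂ) (t : unitInterval) :
      seg p t = p.1 + (t : ℝ) • (p.2 - p.1) := by
    simp [seg, ι, mul_comm]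
  have hseg_x : seg (x, x) = ContinuousMap.const unitInterval x := by
    ext t; simp [hseg_apply]
  have hseg : AnalyticAt ℂ seg (x, x) :=
    (analyticAt_fst.smul analyticAt_const).add
      ((analyticAt_snd.sub analyticAt_fst).smul analyticAt_const)
  have hmain : AnalyticAt ℂ (fun p ↦ unitIntervalIntegralCLM (G (seg p))) (x, x) :=
    (unitIntervalIntegralCLM.analyticAt _).fun_comp ((hseg_x ▸ hG).fun_comp hseg)
  refine hmain.congr ?_
  have hev : ∀ᶠ p in 𝓝 (x, x), ∀ t, G (seg p) t = deriv φ (seg p t) :=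
    hseg.continuousAt.eventually (hseg_x ▸ hGe)
  obtain ⟨ε, hε, hball⟩ := Metric.eventually_nhds_iff_ball.1 hφ.eventually_analyticAt
  filter_upwards [hev, prod_mem_nhds (Metric.ball_mem_nhds x hε) (Metric.ball_mem_nhds x hε)]
    with p hp hpε
  have hd (t : ℝ) (ht : t ∈ Set.Icc (0 : ℝ) 1) :
      AnalyticAt ℂ φ (p.1 + t • (p.2 - p.1)) :=
    hball _ ((convex_ball x ε).add_smul_sub_mem hpε.1 hpε.2 ht)
  have hint : unitIntervalIntegralCLM (G (seg p)) =
      ∫ t in (0 : ℝ)..1, deriv φ (p.1 + t • (p.2 - p.1)) := by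
    rw [unitIntervalIntegralCLM_apply]
    refine intervalIntegral.integral_congr fun t ht ↦ ?_
    rw [Set.uIcc_of_le zero_le_one] at ht
    simp only [hp, hseg_apply, Set.projIcc_of_mem zero_le_one ht]
  have hftc := intervalIntegral.integral_unitInterval_deriv_eq_sub (f := φ) (f' := deriv φ)
    (z₀ := p.1) (z₁ := p.2 - p.1)
    (fun t ht ↦ ContinuousAt.continuousWithinAt <|
      ContinuousAt.comp' (f := fun t : ℝ ↦ p.1 + t • (p.2 - p.1))
        (hd t ht).deriv.continuousAt (by fun_prop))
    (fun t ht ↦ (hd t ht).differentiableAt.hasDerivAt)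
  rw [← hint] at hftc
  by_cases h : p.2 = p.1
  · simp [hint, h]
  · rw [dslope_of_ne _ h, slope_def_field, eq_div_iff (sub_ne_zero.2 h), mul_comm]
    simpa using hftc

/-- Schwarz reflection near a real point: a function analytic at a real point and real-valued on
the reals nearby commutes with conjugation nearby. -/
lemma AnalyticAt.eventually_map_conj {φ : ℂ → ℂ} {x : ℂ} (hφ : AnalyticAt ℂ φ x) (hx : x.im = 0)
    (hreal : ∀ᶠ z in 𝓝 x, z.im = 0 → (φ z).im = 0) :
    ∀ᶠ z in 𝓝 x, φ (conj z) = conj (φ z) := by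
  have hconjx : conj x = x := Complex.conj_eq_iff_im.2 hx
  have hcx : Tendsto conj (𝓝 x) (𝓝 x) := by
    simpa only [hconjx] using Complex.continuous_conj.tendsto x
  have hψ : AnalyticAt ℂ (conj ∘ φ ∘ conj) x := by
    rw [Complex.analyticAt_iff_eventually_differentiableAt] at hφ ⊢
    filter_upwards [hcx.eventually hφ] with z hz
    simpa using hz.conj_conj
  have hfreq : ∃ᶠ z in 𝓝[≠] x, φ z = (conj ∘ φ ∘ conj) z := by
    have hline : Tendsto (fun t : ℝ ↦ x + t) (𝓝[≠] 0) (𝓝[≠] x) := by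
      refine tendsto_nhdsWithin_of_tendsto_nhds_of_eventually_within _ ?_ ?_
      · refine tendsto_nhdsWithin_of_tendsto_nhds ?_
        have : Continuous fun t : ℝ ↦ x + (t : ℂ) := by fun_prop
        simpa using this.tendsto 0
      · filter_upwards [self_mem_nhdsWithin] with t ht
        simpa using ht
    refine hline.frequently (Eventually.frequently ?_)
    filter_upwards [(hline.mono_right nhdsWithin_le_nhds).eventually hreal] with t ht
    have him : (x + (t : ℂ)).im = 0 := by simp [hx]
    simp only [Function.comp_apply, Complex.conj_eq_iff_im.2 him, Complex.conj_eq_iff_im.2 (ht him)]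
  filter_upwards [hcx.eventually ((hφ.frequently_eq_iff_eventually_eq hψ).1 hfreq)] with z hz
  simpa using hz


/-- If `U ⊆ ℂ` is open, connected, invariant under complex conjugation and contains a real
point, and `φ` is holomorphic on `U` and real-valued on `U ∩ ℝ`, then the function
`F z = (φ z - conj (φ z)) / (z - conj z)` for `Im z ≠ 0`, `F x = φ' x` for `Im x = 0`, is
real-analytic on `U` (over `ℝ`, viewing `ℂ` as a two-dimensional real vector space), and
`F z = Im (φ z) / Im z` for every `z ∈ U` with `Im z ≠ 0`. -/
theorem stmt_3 (U : Set ℂ) (hUopen : IsOpen U) (hUconn : IsConnected U)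
    (hUconj : ∀ z : ℂ, z ∈ U ↔ (starRingEnd ℂ) z ∈ U)
    (hUreal : ∃ x ∈ U, x.im = 0)
    (φ : ℂ → ℂ) (hφ : DifferentiableOn ℂ φ U)
    (hφreal : ∀ x ∈ U, x.im = 0 → (φ x).im = 0)
    (F : ℂ → ℂ)
    (hF : ∀ z : ℂ, F z = if z.im = 0 then deriv φ z
      else (φ z - (starRingEnd ℂ) (φ z)) / (z - (starRingEnd ℂ) z)) :
    AnalyticOnNhd ℝ F U ∧
      ∀ z ∈ U, z.im ≠ 0 → F z = (((φ z).im / z.im : ℝ) : ℂ) := by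
  have hφan : AnalyticOnNhd ℂ φ U := hφ.analyticOnNhd hUopen
  have hconj (z : ℂ) : AnalyticAt ℝ (starRingEnd ℂ) z :=
    Complex.conjCLE.toContinuousLinearMap.analyticAt z
  have hsub (z : ℂ) (hz : z.im ≠ 0) : z - conj z ≠ 0 :=
    sub_ne_zero.2 fun h ↦ hz (Complex.conj_eq_iff_im.1 h.symm)
  refine ⟨fun z hz ↦ ?_, fun z _ him ↦ ?_⟩
  · by_cases him : z.im = 0
    · have hcz : conj z = z := Complex.conj_eq_iff_im.2 him
      have hQ : AnalyticAt ℝ (fun w ↦ dslope φ (conj w) w) z := by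
        have h := (hφan z hz).dslope_diag.restrictScalars (𝕜 := ℝ)
        refine AnalyticAt.fun_comp (g := fun p : ℂ × ℂ ↦ dslope φ p.1 p.2)
          (f := fun w ↦ (conj w, w)) (by rwa [hcz]) ((hconj z).prod analyticAt_id)
      refine hQ.congr ?_
      filter_upwards [(hφan z hz).eventually_map_conj him
        (eventually_of_mem (hUopen.mem_nhds hz) hφreal)] with w hw
      rw [hF]
      split_ifs with hwim
      · simp [Complex.conj_eq_iff_im.2 hwim]
      · rw [dslope_of_ne _ (sub_ne_zero.1 (hsub w hwim)), slope_def_field, hw]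
    · have hφz : AnalyticAt ℝ φ z := (hφan z hz).restrictScalars
      have hq : AnalyticAt ℝ (fun w ↦ (φ w - conj (φ w)) / (w - conj w)) z :=
        (hφz.sub ((hconj _).fun_comp hφz)).div (analyticAt_id.sub (hconj z)) (hsub z him)
      refine hq.congr ?_
      filter_upwards [Complex.continuous_im.continuousAt.eventually_ne him] with w hw
      rw [hF, if_neg hw]
  · rw [hF, if_neg him, Complex.sub_conj, Complex.sub_conj, Complex.ofReal_div]
    have : (z.im : ℂ) ≠ 0 := by exact_mod_cast him
    push_cast
    field_simp
end

section
/- Let q ∈ U satisfy Im f(q) = 0, and set U⁺ = {p ∈ U : Im f(p) > 0} and h = g − log(Im f) on U⁺. Then the rescaled real differential Im f(p) · (fderiv ℝ h p) converges in operator norm to −fderiv ℝ (Im ∘ f) q as p tends to q within U⁺. -/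
open Filter

open Metric in
/-- A holomorphic map on an open subset of a proper complex normed space has continuous
derivative. -/
theorem DifferentiableOn.continuousOn_fderiv_of_complex {E F : Type*}
    [NormedAddCommGroup E] [NormedSpace ℂ E] [ProperSpace E]
    [NormedAddCommGroup F] [NormedSpace ℂ F] {f : E → F} {U : Set E}
    (hf : DifferentiableOn ℂ f U) (hU : IsOpen U) : ContinuousOn (fderiv ℂ f) U := by
  intro q hq
  refine ContinuousAt.continuousWithinAt ?_
  obtain ⟨R, hR, hRU⟩ := nhds_basis_closedBall.mem_iff.mp (hU.mem_nhds hq)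
  have huc : UniformContinuousOn f (closedBall q R) :=
    (isCompact_closedBall q R).uniformContinuousOn_of_continuous (hf.continuousOn.mono hRU)
  rw [Metric.uniformContinuousOn_iff] at huc
  rw [Metric.continuousAt_iff]
  intro ε hε
  have hr : 0 < R / 2 := by positivity
  obtain ⟨δ, hδ, hfδ⟩ := huc (ε * (R / 2) / 4) (by positivity)
  refine ⟨min δ (R / 2), by positivity, fun p hp => ?_⟩
  obtain ⟨hpδ, hpr⟩ := lt_min_iff.mp hp
  have hmem : ∀ w ∈ ball q (R / 2), w ∈ closedBall q R ∧ (p - q) + w ∈ closedBall q R := by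
    intro w hw
    rw [mem_ball, dist_eq_norm] at hw
    rw [dist_eq_norm] at hpr
    simp only [mem_closedBall, dist_eq_norm]
    refine ⟨by linarith, ?_⟩
    have := norm_add_le (p - q) (w - q)
    rw [add_sub_assoc]
    linarith
  have hclose : ∀ w ∈ ball q (R / 2), ‖f ((p - q) + w) - f w‖ ≤ ε * (R / 2) / 4 := by
    intro w hw
    rw [← dist_eq_norm]
    refine (hfδ _ (hmem w hw).2 _ (hmem w hw).1 ?_).le
    simpa [dist_eq_norm] using hpδ
  have hd : ∀ x ∈ closedBall q R, DifferentiableAt ℂ f x := fun x hx =>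
    hf.differentiableAt (hU.mem_nhds (hRU hx))
  have hq_mem : q ∈ ball q (R / 2) := mem_ball_self hr
  have hderiv : ∀ w ∈ ball q (R / 2), HasFDerivAt (fun x => f ((p - q) + x) - f x)
      (fderiv ℂ f ((p - q) + w) - fderiv ℂ f w) w := by
    intro w hw
    exact ((hasFDerivAt_comp_add_left (p - q)).mpr (hd _ (hmem w hw).2).hasFDerivAt).sub
      (hd _ (hmem w hw).1).hasFDerivAt
  have key := Complex.norm_fderiv_le_div_of_mapsTo_ball (R₂ := ε * (R / 2) / 2)
    (fun w hw => (hderiv w hw).differentiableAt.differentiableWithinAt)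
    (fun w hw => by
      rw [mem_closedBall, dist_eq_norm]
      have := norm_sub_le (f ((p - q) + w) - f w) (f ((p - q) + q) - f q)
      linarith [hclose w hw, hclose q hq_mem]) hr
  rw [(hderiv q hq_mem).fderiv, sub_add_cancel, ← dist_eq_norm] at key
  have : ε * (R / 2) / 2 / (R / 2) = ε / 2 := by field_simp
  linarith

/-- Let `U ⊆ ℂⁿ` be open, `f : ℂⁿ → ℂ` holomorphic on `U`, `g : ℂⁿ → ℝ` of class `C¹` on
`U`, and `q ∈ U` with `Im f q = 0`. Set `U⁺ = {p ∈ U : Im f p > 0}` and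
`h = g - log (Im f)` on `U⁺`. Then `Im f(p) · (fderiv ℝ h p)` converges in operator norm to
`-fderiv ℝ (Im ∘ f) q` as `p → q` within `U⁺`. -/
theorem stmt_8 (n : ℕ) (U : Set (Fin n → ℂ)) (hUopen : IsOpen U)
    (f : (Fin n → ℂ) → ℂ) (hf : DifferentiableOn ℂ f U)
    (g : (Fin n → ℂ) → ℝ) (hg : ContDiffOn ℝ 1 g U)
    (q : Fin n → ℂ) (hq : q ∈ U) (hqim : (f q).im = 0)
    (Uplus : Set (Fin n → ℂ)) (hUplus : Uplus = {p ∈ U | 0 < (f p).im})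
    (h : (Fin n → ℂ) → ℝ) (hh : ∀ p ∈ Uplus, h p = g p - Real.log ((f p).im)) :
    Tendsto (fun p : Fin n → ℂ => (f p).im • fderiv ℝ h p) (nhdsWithin q Uplus)
      (nhds (-(fderiv ℝ (fun p : Fin n → ℂ => (f p).im) q))) := by
  have hopen : IsOpen Uplus := by
    rw [hUplus]
    exact (Complex.continuous_im.comp_continuousOn hf.continuousOn).isOpen_inter_preimage
      hUopen isOpen_Ioi
  have hderiv : ∀ p ∈ U, HasFDerivAt (fun p => (f p).im)
      (Complex.imCLM.comp ((fderiv ℂ f p).restrictScalars ℝ)) p := fun p hp =>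
    Complex.imCLM.hasFDerivAt.comp p
      ((hf.differentiableAt (hUopen.mem_nhds hp)).hasFDerivAt.restrictScalars ℝ)
  have hsub : Uplus ⊆ U := by
    rw [hUplus]
    exact fun p hp => hp.1
  have heq : ∀ p ∈ Uplus, (f p).im • fderiv ℝ h p = (f p).im • fderiv ℝ g p
      - Complex.imCLM.comp ((fderiv ℂ f p).restrictScalars ℝ) := by
    intro p hp
    have hpos : (f p).im ≠ 0 := by
      rw [hUplus] at hp
      exact hp.2.ne'
    have hgp : HasFDerivAt g (fderiv ℝ g p) p :=
      ((hg.contDiffAt (hUopen.mem_nhds (hsub hp))).differentiableAt one_ne_zero).hasFDerivAt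
    have hhp := (hgp.sub ((hderiv p (hsub hp)).log hpos)).congr_of_eventuallyEq
      (eventually_of_mem (hopen.mem_nhds hp) hh)
    rw [hhp.fderiv, smul_sub, smul_inv_smul₀ hpos]
  have hfq : ContinuousAt f q := (hf.differentiableAt (hUopen.mem_nhds hq)).continuousAt
  have him : Tendsto (fun p => (f p).im) (nhds q) (nhds 0) := by
    exact hqim ▸ (Complex.continuous_im.tendsto (f q)).comp hfq.tendsto
  have hgq : ContinuousAt (fderiv ℝ g) q :=
    (hg.continuousOn_fderiv_of_isOpen hUopen le_rfl).continuousAt (hUopen.mem_nhds hq)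
  have hdf : ContinuousAt (fun p => Complex.imCLM.comp ((fderiv ℂ f p).restrictScalars ℝ)) q := by
    have hc := (hf.continuousOn_fderiv_of_complex hUopen).continuousAt (hUopen.mem_nhds hq)
    exact continuousAt_const.clm_comp
      ((ContinuousLinearMap.continuous_restrictScalars ℝ).continuousAt.comp hc)
  have hlim := (him.smul hgq.tendsto).sub hdf.tendsto
  rw [zero_smul, zero_sub] at hlim
  rw [(hderiv q hq).fderiv]
  exact (hlim.mono_left nhdsWithin_le_nhds).congr'
    (eventually_of_mem self_mem_nhdsWithin fun p hp => (heq p hp).symm)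
end

section
/- Let q ∈ U satisfy Im f(q) = 0 and fderiv ℂ f q ≠ 0, and set U⁺ = {p ∈ U : Im f(p) > 0} and h = g − log(Im f) on U⁺. Then there is a neighbourhood V of q such that fderiv ℝ h p ≠ 0 for every p ∈ V ∩ U⁺. -/
open Filter Topology in
/-- The directional derivatives of a holomorphic function are continuous. -/
theorem continuousAt_fderiv_apply_of_differentiableOn {E : Type*} [NormedAddCommGroup E]
    [NormedSpace ℂ E] {U : Set E} (hU : IsOpen U) {f : E → ℂ} (hf : DifferentiableOn ℂ f U)
    {q : E} (hq : q ∈ U) (v : E) : ContinuousAt (fun p => fderiv ℂ f p v) q := by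
  let line : E × ℂ → E := fun x => x.1 + x.2 • v
  have hline : Continuous line := by fun_prop
  have hmem : line ⁻¹' U ∈ 𝓝 q ×ˢ 𝓝 (0 : ℂ) := by
    rw [← nhds_prod_eq]
    exact (hU.preimage hline).mem_nhds (by simpa [line] using hq)
  obtain ⟨A, hA, B, hB, hAB⟩ := mem_prod_iff.1 hmem
  obtain ⟨r, hr, hrB⟩ := Metric.nhds_basis_closedBall.mem_iff.1 hB
  have hsub : A ×ˢ Metric.closedBall (0 : ℂ) r ⊆ line ⁻¹' U :=
    (Set.prod_mono_right hrB).trans hAB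
  let F : E → ℂ → ℂ := fun p t => f (p + t • v)
  have hFcont : ContinuousOn (Function.uncurry F) (A ×ˢ Metric.closedBall (0 : ℂ) r) :=
    hf.continuousOn.comp hline.continuousOn hsub
  have hlim : TendstoUniformlyOn F (F q) (𝓝 q) (Metric.closedBall 0 r) := by
    intro u hu
    obtain ⟨w, hw, hwu⟩ := (isCompact_closedBall (0 : ℂ) r).mem_uniformity_of_prod hFcont
      (mem_of_mem_nhds hA) (symm_le_uniformity hu)
    rw [nhdsWithin_eq_nhds.2 hA] at hw
    filter_upwards [hw] with p hp t ht using hwu p hp t ht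
  have hdiff : ∀ᶠ p in 𝓝 q, DifferentiableOn ℂ (F p) (Metric.ball 0 r) := by
    filter_upwards [hA] with p hp
    refine hf.comp (f := fun t : ℂ => p + t • v) (by fun_prop) fun t ht => ?_
    exact hsub (Set.mk_mem_prod hp (Metric.ball_subset_closedBall ht))
  have hderiv : ∀ p ∈ U, deriv (F p) 0 = fderiv ℂ f p v := fun p hp => by
    have hfp := (hf.differentiableAt (hU.mem_nhds hp)).hasFDerivAt
    exact (hfp.hasLineDerivAt v).deriv
  have key := ((hlim.mono Metric.ball_subset_closedBall).tendstoLocallyUniformlyOn.deriv hdiff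
    Metric.isOpen_ball).tendsto_at (Metric.mem_ball_self hr)
  simp only [Function.comp_apply, hderiv q hq] at key
  refine key.congr' ?_
  filter_upwards [hU.mem_nhds hq] with p hp using hderiv p hp


/-- Let `U ⊆ ℂⁿ` be open, `f : ℂⁿ → ℂ` holomorphic on `U`, `g : ℂⁿ → ℝ` of class `C¹` on
`U`, and `q ∈ U` with `Im f q = 0` and `df_q ≠ 0`. Set `U⁺ = {p ∈ U : Im f p > 0}` and
`h = g - log (Im f)` on `U⁺`. Then there is a neighbourhood `V` of `q` such that `h` has no
critical point on `V ∩ U⁺`. -/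
theorem stmt_9 (n : ℕ) (U : Set (Fin n → ℂ)) (hUopen : IsOpen U)
    (f : (Fin n → ℂ) → ℂ) (hf : DifferentiableOn ℂ f U)
    (g : (Fin n → ℂ) → ℝ) (hg : ContDiffOn ℝ 1 g U)
    (q : Fin n → ℂ) (hq : q ∈ U) (hqim : (f q).im = 0) (hqd : fderiv ℂ f q ≠ 0)
    (Uplus : Set (Fin n → ℂ)) (hUplus : Uplus = {p ∈ U | 0 < (f p).im})
    (h : (Fin n → ℂ) → ℝ) (hh : ∀ p ∈ Uplus, h p = g p - Real.log ((f p).im)) :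
    ∃ V ∈ nhds q, ∀ p ∈ V ∩ Uplus, fderiv ℝ h p ≠ 0 := by
  obtain ⟨v, hv⟩ : ∃ v, (fderiv ℂ f q v).im ≠ 0 := by
    obtain ⟨w, hw⟩ := DFunLike.exists_ne hqd
    simp only [zero_apply] at hw
    refine ⟨(Complex.I / fderiv ℂ f q w) • w, ?_⟩
    simp [map_smul, div_mul_cancel₀ _ hw]
  have hfd : ContinuousAt (fun p => (fderiv ℂ f p v).im) q :=
    Complex.continuous_im.continuousAt.comp (continuousAt_fderiv_apply_of_differentiableOn hUopen hf hq v)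
  have hfim : ContinuousOn (fun p => (f p).im) U :=
    Complex.continuous_im.comp_continuousOn hf.continuousOn
  have hgd : ContinuousAt (fun p => fderiv ℝ g p v) q :=
    ((hg.continuousOn_fderiv_of_isOpen hUopen le_rfl).continuousAt
      (hUopen.mem_nhds hq)).clm_apply continuousAt_const
  have hne := (((hfim.continuousAt (hUopen.mem_nhds hq)).mul hgd).sub hfd).eventually_ne
    (y := 0) (by simpa [hqim] using hv)
  refine ⟨_, hne, ?_⟩
  rintro p ⟨hpV, hpU⟩ hzero
  have hopen : IsOpen Uplus := by
    rw [hUplus]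
    exact hfim.isOpen_inter_preimage hUopen isOpen_Ioi
  obtain ⟨hp, hpos⟩ : p ∈ U ∧ 0 < (f p).im := by simpa [hUplus] using hpU
  have hgp := ((hg.differentiableOn one_ne_zero).differentiableAt
    (hUopen.mem_nhds hp)).hasFDerivAt
  have hfp := (hf.differentiableAt (hUopen.mem_nhds hp)).hasFDerivAt.restrictScalars ℝ
  have him := Complex.imCLM.hasFDerivAt.comp p hfp
  have hhp := (hgp.sub (him.log hpos.ne')).congr_of_eventuallyEq
    (f₁ := h) (by filter_upwards [hopen.mem_nhds hpU] with x hx using hh x hx)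
  have hval : fderiv ℝ g p v - ((f p).im)⁻¹ * (fderiv ℂ f p v).im = 0 := by
    simpa using congrArg (fun L => L v) (hhp.fderiv.symm.trans hzero)
  apply hpV
  change (f p).im * fderiv ℝ g p v - (fderiv ℂ f p v).im = 0
  field_simp at hval
  linarith
end
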